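/- arXiv:2207.05235 — 3 statements merged into one kernel-verified Lean document; each statement's English description precedes it below -/
import Mathlib

section
/- Let A be a commutative Noetherian ring. Then the set of prime ideals p of A such that the localization A_p is a reduced ring is an open subset of the prime spectrum Spec A in the Zariski topology. -/
/-- The localization at `p` is reduced iff `p` is not in the support of the nilradical. -/
theorem isReduced_localization_atPrime_iff_notMem_support_nilradical {A : Type*} [CommRing A]
    (p : PrimeSpectrum A) :
    IsReduced (Localization.AtPrime p.asIdeal) ↔ p ∉ Module.support A (nilradical A) := by
  rw [Module.notMem_support_iff']
  constructor
  · rintro h ⟨x, hx⟩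
    have hnil : IsNilpotent (algebraMap A (Localization.AtPrime p.asIdeal) x) :=
      IsNilpotent.map (mem_nilradical.mp hx) _
    obtain ⟨r, hr⟩ := (IsLocalization.map_eq_zero_iff p.asIdeal.primeCompl _ x).mp hnil.eq_zero
    exact ⟨r, r.2, Subtype.ext hr⟩
  · refine fun h ↦ ⟨fun y ⟨n, hn⟩ ↦ ?_⟩
    obtain ⟨x, s, rfl⟩ := IsLocalization.exists_mk'_eq p.asIdeal.primeCompl y
    rw [← IsLocalization.mk'_pow, IsLocalization.mk'_eq_zero_iff] at hn
    obtain ⟨t, ht⟩ := hn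
    have hnil : (t : A) * x ∈ nilradical A := by
      refine mem_nilradical.mpr ⟨n + 1, ?_⟩
      linear_combination (t : A) ^ n * x * ht
    obtain ⟨r, hr, hrx⟩ := h ⟨_, hnil⟩
    refine (IsLocalization.mk'_eq_zero_iff x s).mpr ⟨⟨r, hr⟩ * t, ?_⟩
    simpa [mul_assoc] using congrArg Subtype.val hrx

/-- For a commutative Noetherian ring `A`, the set of primes `p` such that the
localization `A_p` is reduced is open in `Spec A`. -/
theorem reduced_locus_isOpen (A : Type*) [CommRing A] [IsNoetherianRing A] :
    IsOpen {p : PrimeSpectrum A | IsReduced (Localization.AtPrime p.asIdeal)} := by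
  simp_rw [isReduced_localization_atPrime_iff_notMem_support_nilradical]
  exact (Module.isClosed_support (R := A) (M := nilradical A)).isOpen_compl
end

section
/- Let K be a field, let A be a commutative K-algebra of finite type which is reduced, and let m be a maximal ideal of A. Then the m-adic completion of A (the inverse limit of the rings A/m^n over n ≥ 1) is a reduced ring. -/
open TensorProduct

universe u v

/-- Sequential form of reducedness of the `I`-adic completion. -/
def IsAdicallyReduced {A : Type*} [CommRing A] (I : Ideal A) : Prop :=
  ∀ a : ℕ → A, (∀ k, a (k + 1) - a k ∈ I ^ k) → (∀ k, a k ^ 2 ∈ I ^ k) → ∀ k, a k ∈ I ^ k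

theorem sub_mem_pow_of_forall_succ {A : Type*} [CommRing A] {I : Ideal A} {a : ℕ → A}
    (ha : ∀ k, a (k + 1) - a k ∈ I ^ k) {k l : ℕ} (hkl : k ≤ l) : a l - a k ∈ I ^ k := by
  induction l, hkl using Nat.le_induction with
  | base => simp
  | succ l hl ih =>
    simpa using add_mem (Ideal.pow_le_pow_right hl (ha l)) ih

theorem IsAdicallyReduced.isReduced_adicCompletion {A : Type*} [CommRing A] {I : Ideal A}
    (h : IsAdicallyReduced I) : IsReduced (AdicCompletion I A) := by
  rw [isReduced_iff_pow_one_lt 2 one_lt_two]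
  intro x hx
  obtain ⟨a, rfl⟩ := AdicCompletion.mk_surjective I A x
  have key : ∀ k, a k ∈ I ^ k := by
    refine h a (fun k ↦ ?_) (fun k ↦ ?_)
    · simpa [SModEq.sub_mem] using (a.2 k.le_succ).symm
    · rw [← Ideal.Quotient.eq_zero_iff_mem, map_pow, ← AdicCompletion.evalₐ_mk, ← map_pow, hx,
        map_zero]
  refine AdicCompletion.ext_evalₐ fun k ↦ ?_
  rw [AdicCompletion.evalₐ_mk, map_zero, Ideal.Quotient.eq_zero_iff_mem]
  exact key k

theorem IsAdicallyReduced.of_forall_minimalPrimes {A : Type*} [CommRing A] [IsNoetherianRing A]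
    [IsReduced A] (I : Ideal A)
    (h : ∀ p ∈ minimalPrimes A, IsAdicallyReduced (I.map (Ideal.Quotient.mk p))) :
    IsAdicallyReduced I := by
  classical
  intro a ha hsq k
  have : Fintype (minimalPrimes A) := (minimalPrimes.finite_of_isNoetherianRing A).fintype
  let f : A →ₗ[A] (∀ p : minimalPrimes A, A ⧸ p.1) := LinearMap.pi fun p ↦ p.1.mkQ
  have hf : Function.Injective f := by
    rw [injective_iff_map_eq_zero]
    intro x hx
    have hmem : x ∈ sInf (minimalPrimes A) := by
      rw [Ideal.mem_sInf]
      intro p hp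
      exact (Submodule.Quotient.mk_eq_zero _).mp (congrFun hx ⟨p, hp⟩)
    rw [minimalPrimes, Ideal.sInf_minimalPrimes, Ideal.radical_bot_of_isReduced] at hmem
    simpa using hmem
  have hfa (k : ℕ) : f (a k) ∈ (I ^ k • ⊤ : Submodule A (∀ p : minimalPrimes A, A ⧸ p.1)) := by
    have hc (p : minimalPrimes A) : ∃ c ∈ I ^ k,
        Ideal.Quotient.mk p.1 c = Ideal.Quotient.mk p.1 (a k) := by
      rw [← Ideal.mem_map_iff_of_surjective _ Ideal.Quotient.mk_surjective, Ideal.map_pow]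
      refine h p.1 p.2 (fun k ↦ Ideal.Quotient.mk p.1 (a k)) (fun k ↦ ?_) (fun k ↦ ?_) k
      · rw [← map_sub, ← Ideal.map_pow]
        exact Ideal.mem_map_of_mem _ (ha k)
      · rw [← map_pow, ← Ideal.map_pow]
        exact Ideal.mem_map_of_mem _ (hsq k)
    choose c hcI hc using hc
    have : f (a k) = ∑ p, c p • Pi.single p 1 := by
      ext p
      rw [Finset.sum_apply, Finset.sum_eq_single p]
      · simp only [Pi.smul_apply, Pi.single_eq_same, Algebra.smul_def, mul_one]
        exact (hc p).symm
      · intro q _ hq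
        simp [Pi.single_eq_of_ne hq.symm]
      · simp
    rw [this]
    exact sum_mem fun p _ ↦ Submodule.smul_mem_smul (hcI p) trivial
  obtain ⟨k₀, hk₀⟩ := Ideal.exists_pow_inf_eq_pow_smul I (LinearMap.range f)
  have h1 : f (a (k + k₀)) ∈ I ^ k • LinearMap.range f := by
    have h2 : f (a (k + k₀)) ∈ I ^ (k + k₀) • ⊤ ⊓ LinearMap.range f :=
      ⟨hfa _, LinearMap.mem_range_self _ _⟩
    rw [hk₀ _ (Nat.le_add_left _ _), Nat.add_sub_cancel] at h2
    exact Submodule.smul_mono le_rfl inf_le_right h2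
  rw [LinearMap.range_eq_map, ← Submodule.map_smul''] at h1
  obtain ⟨b, hb, hbf⟩ := h1
  rw [hf hbf] at hb
  simp only [smul_eq_mul, Ideal.mul_top, SetLike.mem_coe] at hb
  simpa using sub_mem hb (sub_mem_pow_of_forall_succ ha (Nat.le_add_right k k₀))

theorem Ideal.exists_one_sub_mem_and_mul_mem_of_isArtinianRing_quotient {A : Type*} [CommRing A]
    {I : Ideal A} [IsNoetherianRing A] [IsArtinianRing (A ⧸ I)] (m : Ideal A) :
    ∃ (r : ℕ) (e : A), 1 - e ∈ m ∧ ∀ x ∈ m ^ r, e * x ∈ I := by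
  set B := A ⧸ I
  set m' : Ideal B := m.map (Ideal.Quotient.mk I)
  obtain ⟨r, hr⟩ := IsArtinian.monotone_stabilizes (R := B) (M := B)
    ⟨fun n ↦ OrderDual.toDual (m' ^ n), fun a b hab ↦ Ideal.pow_le_pow_right hab⟩
  have hr1 : m' ^ r = m' ^ (r + 1) := hr (r + 1) r.le_succ
  obtain ⟨t, ht, hts⟩ := Submodule.exists_sub_one_mem_and_smul_eq_zero_of_fg_of_le_smul m' (m' ^ r)
    (IsNoetherian.noetherian _) (by rw [smul_eq_mul, ← pow_succ', ← hr1])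
  obtain ⟨u, hu, hut⟩ := (Ideal.mem_map_iff_of_surjective _ Ideal.Quotient.mk_surjective).mp ht
  refine ⟨r, 1 + u, by simpa using hu, fun x hx ↦ ?_⟩
  rw [← Ideal.Quotient.eq_zero_iff_mem, map_mul, map_add, map_one, hut]
  have := hts (Ideal.Quotient.mk I x) (by rw [← Ideal.map_pow]; exact Ideal.mem_map_of_mem _ hx)
  simpa using this

theorem IsAdicallyReduced.of_le {A : Type*} [CommRing A] [IsNoetherianRing A] {I m : Ideal A}
    [IsArtinianRing (A ⧸ I)] (hIm : I ≤ m) (h : IsAdicallyReduced I) : IsAdicallyReduced m := by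
  intro a ha hsq
  obtain ⟨r, e, he, hmul⟩ :=
    Ideal.exists_one_sub_mem_and_mul_mem_of_isArtinianRing_quotient (I := I) m
  have hmulpow (k : ℕ) (x) (hx : x ∈ m ^ (r * k)) : e ^ k * x ∈ I ^ k := by
    have : Ideal.span {e} * m ^ r ≤ I := by
      rw [Ideal.span_singleton_mul_le_iff]
      exact hmul
    have := Ideal.pow_right_mono this k
    rw [mul_pow, Ideal.span_singleton_pow, ← pow_mul, Ideal.span_singleton_mul_le_iff] at this
    exact this x hx
  -- idempotents modulo `I ^ k` approximating the projection to the `m`-adic factor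
  let ε (k : ℕ) : A := 1 - (1 - e ^ k) ^ ((r + 1) * k)
  have hε (k : ℕ) : 1 - ε k ∈ m ^ ((r + 1) * k) := by
    simp only [ε, sub_sub_cancel]
    refine Ideal.pow_mem_pow ?_ _
    refine Ideal.mem_of_dvd _ ?_ he
    simpa using sub_dvd_pow_sub_pow 1 e k
  have hdvd (k : ℕ) : e ^ k ∣ ε k := by
    have := sub_dvd_pow_sub_pow 1 (1 - e ^ k) ((r + 1) * k)
    simpa [ε] using this
  have hεmul (k l : ℕ) (hkl : k ≤ l) (x) (hx : x ∈ m ^ ((r + 1) * k)) : ε l * x ∈ I ^ k := by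
    obtain ⟨c, hc⟩ := (pow_dvd_pow e hkl).trans (hdvd l)
    rw [hc, mul_right_comm]
    refine Ideal.mul_mem_right _ _ (hmulpow k x (Ideal.pow_le_pow_right ?_ hx))
    gcongr; omega
  have hεsub (k : ℕ) : ε (k + 1) - ε k ∈ I ^ k := by
    have h1 := hεmul k (k + 1) k.le_succ _ (hε k)
    have h2 := hεmul k k le_rfl _ (Ideal.pow_le_pow_right (by gcongr; omega) (hε (k + 1)))
    convert sub_mem h1 h2 using 1
    ring
  have key := h (fun k ↦ ε k * a ((r + 1) * k)) (fun k ↦ ?_) (fun k ↦ ?_)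
  · intro k
    have h1 : a ((r + 1) * k) ∈ m ^ k := by
      have h2 := Ideal.pow_right_mono hIm k (key k)
      have h3 : (1 - ε k) * a ((r + 1) * k) ∈ m ^ k :=
        Ideal.mul_mem_right _ _ (Ideal.pow_le_pow_right (Nat.le_mul_of_pos_left _ r.succ_pos) (hε k))
      convert add_mem h2 h3 using 1
      ring
    simpa using sub_mem h1 (sub_mem_pow_of_forall_succ ha (Nat.le_mul_of_pos_left k r.succ_pos))
  · have h1 := Ideal.mul_mem_right (a ((r + 1) * (k + 1))) _ (hεsub k)
    have h2 := hεmul k k le_rfl _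
      (sub_mem_pow_of_forall_succ ha (show (r + 1) * k ≤ (r + 1) * (k + 1) by gcongr; omega))
    convert add_mem h1 h2 using 1
    ring
  · have h1 := Ideal.mul_mem_left _ (ε k) (hεmul k k le_rfl _ (hsq ((r + 1) * k)))
    convert h1 using 1
    ring

theorem IsAdicallyReduced.of_isReduced_tensorProduct {P A : Type u} [CommRing P] [CommRing A]
    [Algebra P A] [IsNoetherianRing P] [Module.Finite P A] {I : Ideal P}
    (h : IsReduced (AdicCompletion I P ⊗[P] A)) : IsAdicallyReduced (I.map (algebraMap P A)) := by
  have hmem (k : ℕ) (x : A) : x ∈ (I ^ k • ⊤ : Submodule P A) ↔ x ∈ I.map (algebraMap P A) ^ k := by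
    rw [Ideal.smul_top_eq_map, Ideal.map_pow]
    rfl
  let E (k : ℕ) : AdicCompletion I P ⊗[P] A →ₐ[P] A ⧸ (I ^ k).map (algebraMap P A) :=
    Algebra.TensorProduct.productMap
      ((Ideal.quotientMapₐ _ (Algebra.ofId P A) Ideal.le_comap_map).comp (AdicCompletion.evalₐ I k))
      (Ideal.Quotient.mkₐ P _)
  have hE (k : ℕ) (t : AdicCompletion I P ⊗[P] A) : ∃ b : A, E k t = Ideal.Quotient.mk _ b ∧
      (AdicCompletion.ofTensorProduct I A t).val k = Submodule.Quotient.mk b := by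
    induction t with
    | zero => exact ⟨0, by simp, by simp⟩
    | add x y hx hy =>
      obtain ⟨b, hb, hb'⟩ := hx
      obtain ⟨c, hc, hc'⟩ := hy
      exact ⟨b + c, by simp [hb, hc], by simp [hb', hc']⟩
    | tmul r x =>
      obtain ⟨r, rfl⟩ := AdicCompletion.mk_surjective I P r
      refine ⟨r k • x, ?_, ?_⟩
      · simp only [E, Algebra.smul_def, map_mul]
        rfl
      · simp only [AdicCompletion.ofTensorProduct_tmul]
        rfl
  have hE0 (k : ℕ) (t : AdicCompletion I P ⊗[P] A) :
      E k t = 0 ↔ (AdicCompletion.ofTensorProduct I A t).val k = 0 := by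
    obtain ⟨b, hb, hb'⟩ := hE k t
    rw [hb, hb', Ideal.Quotient.eq_zero_iff_mem, Submodule.Quotient.mk_eq_zero, hmem, Ideal.map_pow]
  intro a ha hsq k
  let α : AdicCompletion.AdicCauchySequence I A := ⟨a, fun {i j} hij ↦ by
    rw [SModEq.comm, SModEq.sub_mem, hmem]
    exact sub_mem_pow_of_forall_succ ha hij⟩
  obtain ⟨t, ht⟩ := (AdicCompletion.ofTensorProduct_bijective_of_finite_of_isNoetherian I A).2
    (AdicCompletion.mk I A α)
  have hval (k : ℕ) : (AdicCompletion.ofTensorProduct I A t).val k = Submodule.Quotient.mk (a k) := by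
    rw [ht]
    rfl
  have hEa (k : ℕ) : E k t = Ideal.Quotient.mk _ (a k) := by
    obtain ⟨b, hb, hb'⟩ := hE k t
    rw [hb, Ideal.Quotient.eq, Ideal.map_pow, ← hmem, ← Submodule.Quotient.eq, ← hb', hval]
  have htsq : t ^ 2 = 0 := by
    apply (AdicCompletion.ofTensorProduct_bijective_of_finite_of_isNoetherian I A).1
    ext k
    rw [map_zero, AdicCompletion.val_zero_apply, ← hE0, map_pow, hEa, ← map_pow,
      Ideal.Quotient.eq_zero_iff_mem, Ideal.map_pow]
    exact hsq k
  have ht0 : t = 0 := pow_eq_zero_iff two_ne_zero |>.mp htsq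
  rw [← Ideal.map_pow, ← Ideal.Quotient.eq_zero_iff_mem, ← hEa, ht0, map_zero]

theorem MvPowerSeries.coeff_pow_expChar_pow {σ K : Type*} [Finite σ] [Field K] (q : ℕ)
    [ExpChar K q] (n : ℕ) (f : MvPowerSeries σ K) (m : σ →₀ ℕ) :
    coeff (q ^ n • m) (f ^ q ^ n) = coeff m f ^ q ^ n := by
  rw [← map_iterateFrobenius_expand q (expChar_ne_zero K q), coeff_map, coeff_expand_smul,
    iterateFrobenius_def]

theorem MvPowerSeries.coeff_pow_expChar_pow_of_not_dvd {σ K : Type*} [Finite σ] [Field K] (q : ℕ)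
    [ExpChar K q] (n : ℕ) (f : MvPowerSeries σ K) {m : σ →₀ ℕ} {i : σ} (h : ¬ q ^ n ∣ m i) :
    coeff m (f ^ q ^ n) = 0 := by
  rw [← map_iterateFrobenius_expand q (expChar_ne_zero K q), coeff_map,
    coeff_expand_of_not_dvd _ _ _ h, map_zero]

/-- The family `β` generates the field `F` over its subfield of `q ^ n`-th powers, and it is
linearly independent over the `q ^ n`-th powers in the extension `R`. -/
structure IsFrobeniusBasis (F R : Type*) [Field F] [Field R] [Algebra F R] (q n : ℕ) {J : Type*}
    (β : J → F) : Prop where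
  exists_eq_sum (f : F) : ∃ c : J →₀ F, f = c.sum fun j x ↦ x ^ q ^ n * β j
  eq_zero_of_sum_eq_zero (t : Finset J) (c : J → R)
    (h : ∑ j ∈ t, c j ^ q ^ n * algebraMap F R (β j) = 0) : ∀ j ∈ t, c j = 0

section

variable {K : Type u} [Field K] (q : ℕ) [ExpChar K q] (n : ℕ)

theorem exists_basis_expChar_pow : ∃ (ι : Type u) (e : ι → K),
    (∀ a : K, ∃ c : ι →₀ K, a = c.sum fun j x ↦ x ^ q ^ n * e j) ∧
    ∀ (t : Finset ι) (c : ι → K), ∑ j ∈ t, c j ^ q ^ n * e j = 0 → ∀ j ∈ t, c j = 0 := by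
  classical
  let K₀ := (iterateFrobenius K q n).fieldRange
  let e := Module.Basis.ofVectorSpace K₀ K
  have hK₀ (x : K₀) : ∃ y : K, y ^ q ^ n = x := x.2
  choose r hr using hK₀
  have hr0 : r 0 = 0 := by
    have := hr 0
    exact eq_zero_of_pow_eq_zero (n := q ^ n) (by simpa using this)
  refine ⟨_, e, fun a ↦ ⟨(e.repr a).mapRange r hr0, ?_⟩, fun t c h j hj ↦ ?_⟩
  · rw [Finsupp.sum_mapRange_index (by simp [zero_pow (expChar_pow_pos K q n).ne'])]
    conv_lhs => rw [← e.linearCombination_repr a, Finsupp.linearCombination_apply]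
    simp only [hr]
    rfl
  · have := linearIndependent_iff'.mp e.linearIndependent t
      (fun j ↦ ⟨c j ^ q ^ n, c j, rfl⟩) h j hj
    exact eq_zero_of_pow_eq_zero (congrArg Subtype.val this)

theorem exists_eq_sum_of_isFractionRing_mvPolynomial {σ F : Type*} [Field F]
    [Algebra (MvPolynomial σ K) F] [IsFractionRing (MvPolynomial σ K) F] [ExpChar F q]
    {ι : Type*} {e : ι → K} (he : ∀ a : K, ∃ c : ι →₀ K, a = c.sum fun j x ↦ x ^ q ^ n * e j) (f : F) :
    ∃ c : ι × {α : σ →₀ ℕ // ∀ i, α i < q ^ n} →₀ F, f = c.sum fun j x ↦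
      x ^ q ^ n * algebraMap (MvPolynomial σ K) F (MvPolynomial.monomial j.2 (e j.1)) := by
  classical
  have hq : q ^ n ≠ 0 := (expChar_pow_pos K q n).ne'
  have hqpos : 0 < q ^ n := (expChar_pow_pos K q n)
  let S : AddSubmonoid F :=
    { carrier := {f | ∃ c : ι × {α : σ →₀ ℕ // ∀ i, α i < q ^ n} →₀ F, f = c.sum fun j x ↦
        x ^ q ^ n * algebraMap (MvPolynomial σ K) F (MvPolynomial.monomial j.2 (e j.1))}
      zero_mem' := ⟨0, by simp⟩
      add_mem' := by
        rintro _ _ ⟨c, rfl⟩ ⟨d, rfl⟩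
        refine ⟨c + d, ?_⟩
        rw [Finsupp.sum_add_index']
        · simp [zero_pow hq]
        · intro j x y
          rw [add_pow_expChar_pow, add_mul] }
  have hsingle (x : F) (j : ι) (α : σ →₀ ℕ) (hα : ∀ i, α i < q ^ n) :
      x ^ q ^ n * algebraMap (MvPolynomial σ K) F (MvPolynomial.monomial α (e j)) ∈ S :=
    ⟨Finsupp.single (j, ⟨α, hα⟩) x, by rw [Finsupp.sum_single_index (by simp [zero_pow hq])]⟩
  have hmul (g f : F) (hf : f ∈ S) : g ^ q ^ n * f ∈ S := by
    obtain ⟨c, rfl⟩ := hf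
    rw [Finsupp.mul_sum]
    refine sum_mem fun j _ ↦ ?_
    simp only
    rw [← mul_assoc, ← mul_pow]
    exact hsingle _ _ _ j.2.2
  have hP (u : MvPolynomial σ K) : algebraMap _ F u ∈ S := by
    induction u using MvPolynomial.induction_on' with
    | add p q hp hq => rw [map_add]; exact add_mem hp hq
    | monomial m a =>
      obtain ⟨c, hc⟩ := he a
      let m₁ : σ →₀ ℕ := m.mapRange (· / q ^ n) (by simp)
      let m₂ : σ →₀ ℕ := m.mapRange (· % q ^ n) (by simp)
      have hm : m = q ^ n • m₁ + m₂ := by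
        ext i
        exact (Nat.div_add_mod (m i) (q ^ n)).symm
      have : MvPolynomial.monomial m a = c.sum fun j x ↦
          (MvPolynomial.monomial m₁ x) ^ q ^ n * MvPolynomial.monomial m₂ (e j) := by
        conv_lhs => rw [hc, hm, Finsupp.sum, map_sum]
        simp only [MvPolynomial.monomial_pow, MvPolynomial.monomial_mul]
        rfl
      rw [this, Finsupp.sum, map_sum]
      refine sum_mem fun j _ ↦ ?_
      rw [map_mul, map_pow]
      exact hsingle _ _ _ fun i ↦ Nat.mod_lt _ hqpos
  obtain ⟨u, v, hv, rfl⟩ := IsFractionRing.div_surjective (A := MvPolynomial σ K) f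
  have hv0 : algebraMap _ F v ≠ 0 := by
    simpa using nonZeroDivisors.ne_zero hv
  have : algebraMap _ F u / algebraMap _ F v =
      ((algebraMap _ F v)⁻¹) ^ q ^ n * algebraMap _ F (u * v ^ (q ^ n - 1)) := by
    obtain ⟨Q, hQ⟩ := Nat.exists_eq_succ_of_ne_zero hq
    rw [hQ, map_mul, map_pow]
    simp only [Nat.succ_eq_add_one, Nat.add_sub_cancel]
    rw [inv_pow, pow_succ]
    field_simp
  rw [this]
  exact hmul _ _ (hP _)

theorem MvPowerSeries.eq_zero_of_sum_pow_mul_monomial_eq_zero {σ ι : Type*} [Finite σ] {e : ι → K}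
    (he : ∀ (t : Finset ι) (c : ι → K), ∑ j ∈ t, c j ^ q ^ n * e j = 0 → ∀ j ∈ t, c j = 0)
    (t : Finset (ι × {α : σ →₀ ℕ // ∀ i, α i < q ^ n}))
    (s : ι × {α : σ →₀ ℕ // ∀ i, α i < q ^ n} → MvPowerSeries σ K)
    (h : ∑ j ∈ t, s j ^ q ^ n * monomial j.2.1 (e j.1) = 0) : ∀ j ∈ t, s j = 0 := by
  classical
  rintro ⟨j₀, α⟩ hj
  ext m
  have hsum : ∑ j ∈ (t.filter fun j ↦ j.2 = α).image Prod.fst,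
      coeff m (s (j, α)) ^ q ^ n * e j = 0 := by
    have h1 := congrArg (coeff (q ^ n • m + α.1)) h
    rw [map_sum, map_zero] at h1
    rw [← h1, Finset.sum_image, Finset.sum_filter]
    · refine Finset.sum_congr rfl ?_
      rintro ⟨j, α'⟩ _
      simp only
      rw [coeff_mul_monomial]
      split_ifs with h2 h3 h3
      · subst h2
        rw [add_tsub_cancel_right, coeff_pow_expChar_pow]
      · subst h2
        simp at h3
      · obtain ⟨i, hi⟩ : ∃ i, α'.1 i ≠ α.1 i := by
          by_contra! hcon
          exact h2 (Subtype.ext (Finsupp.ext hcon))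
        rw [coeff_pow_expChar_pow_of_not_dvd q n _ (i := i), zero_mul]
        intro hdvd
        apply hi
        have h4 : α'.1 i ≤ q ^ n * m i + α.1 i := by simpa using h3 i
        have h5 : q ^ n ∣ q ^ n * m i + α.1 i - α'.1 i := by simpa using hdvd
        have h6 := (Nat.modEq_iff_dvd' h4).mpr h5
        have h7 : α'.1 i % q ^ n = α.1 i % q ^ n := by simpa [Nat.ModEq] using h6
        rwa [Nat.mod_eq_of_lt (α'.2 i), Nat.mod_eq_of_lt (α.2 i)] at h7
      · rfl
    · rintro ⟨j, a⟩ hj ⟨j', a'⟩ hj' h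
      simp_all
  have := he _ (fun j ↦ coeff m (s (j, α))) hsum j₀ (by
    simp only [Finset.mem_image, Finset.mem_filter]
    exact ⟨(j₀, α), ⟨hj, rfl⟩, rfl⟩)
  simpa using this

end

theorem IsFractionRing.exists_algebraMap_eq_mul {T R : Type*} [CommRing T] [Field R]
    [Algebra T R] [IsFractionRing T R] {J : Type*} (t : Finset J) (c : J → R) :
    ∃ (d : T) (s : J → T), algebraMap T R d ≠ 0 ∧
      ∀ j ∈ t, algebraMap T R (s j) = algebraMap T R d * c j := by
  classical
  obtain ⟨d, hd⟩ := IsLocalization.exist_integer_multiples_of_finset (nonZeroDivisors T) (t.image c)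
  have hd' (j) (hj : j ∈ t) : ∃ s, algebraMap T R s = algebraMap T R d.1 * c j := by
    obtain ⟨s, hs⟩ := hd _ (Finset.mem_image_of_mem c hj)
    exact ⟨s, by rw [hs, Algebra.smul_def]⟩
  choose! s hs using hd'
  exact ⟨d.1, s, (IsLocalization.map_units R d).ne_zero, hs⟩

theorem exists_isFrobeniusBasis_mvPowerSeries (K : Type u) [Field K] (q : ℕ) [ExpChar K q] (n : ℕ)
    (σ : Type v) [Finite σ] (F R : Type*) [Field F] [Field R] [Algebra F R] [ExpChar F q]
    [Algebra (MvPolynomial σ K) F] [IsFractionRing (MvPolynomial σ K) F]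
    [Algebra (MvPowerSeries σ K) R] [IsFractionRing (MvPowerSeries σ K) R]
    (hcomp : ∀ x : MvPolynomial σ K, algebraMap F R (algebraMap _ F x) =
      algebraMap (MvPowerSeries σ K) R x) :
    ∃ (J : Type (max u v)) (β : J → F), IsFrobeniusBasis F R q n β := by
  classical
  obtain ⟨ι, e, he, he'⟩ := exists_basis_expChar_pow (K := K) q n
  let β (j : ι × {α : σ →₀ ℕ // ∀ i, α i < q ^ n}) : F :=
    algebraMap (MvPolynomial σ K) F (MvPolynomial.monomial j.2 (e j.1))
  have hβ (f : F) : ∃ c : ι × {α : σ →₀ ℕ // ∀ i, α i < q ^ n} →₀ F,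
      f = c.sum fun j x ↦ x ^ q ^ n * β j :=
    exists_eq_sum_of_isFractionRing_mvPolynomial q n he f
  refine ⟨_, β, hβ, fun t c h ↦ ?_⟩
  obtain ⟨d, s, hd0, hs⟩ := IsFractionRing.exists_algebraMap_eq_mul (T := MvPowerSeries σ K) t c
  have key := MvPowerSeries.eq_zero_of_sum_pow_mul_monomial_eq_zero q n he' t s <| by
    apply IsFractionRing.injective (MvPowerSeries σ K) R
    rw [map_zero, map_sum, ← mul_zero (algebraMap (MvPowerSeries σ K) R d ^ q ^ n), ← h,
      Finset.mul_sum]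
    refine Finset.sum_congr rfl fun j hj ↦ ?_
    rw [map_mul, map_pow, hs j hj, mul_pow, mul_assoc, hcomp,
      MvPolynomial.coe_monomial]
  intro j hj
  have := hs j hj
  rw [key j hj, map_zero] at this
  exact (mul_eq_zero.mp this.symm).resolve_left hd0

section
theorem isReduced_tensorProduct_of_isSeparable_of_isField {G N M : Type*} [Field G] [Field N]
    [Algebra G N] [Algebra.IsSeparable G N] [CommRing M] [Algebra G M] (hM : IsField M) :
    IsReduced (N ⊗[G] M) := by
  suffices IsReduced (M ⊗[G] N) from
    isReduced_of_injective _ (Algebra.TensorProduct.comm G N M).injective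
  obtain ⟨_, rfl⟩ : ∃ i : Field M, i.toCommRing = ‹CommRing M› := ⟨hM.toField, rfl⟩
  refine IsReduced.tensorProduct_of_flat_of_forall_fg fun B hB ↦ ?_
  have : Algebra.FiniteType G B := B.fg_iff_finiteType.mp hB
  have hfield : IsField B := Subalgebra.isField_of_algebraic B
  let : Field B := hfield.toField
  have : Algebra.IsSeparable G B := Algebra.IsSeparable.of_algHom G N B.val
  have : Algebra.FormallyUnramified G B := Algebra.FormallyUnramified.of_isSeparable G B
  exact Algebra.FormallyUnramified.isReduced_of_field M (M ⊗[G] B)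

theorem isReduced_tensorProduct_of_isScalarTower {F G R : Type*} [Field F] [Field G] [CommRing R]
    [Algebra F G] [Algebra F R] (hM : IsField (G ⊗[F] R)) (N : Type*) [Field N] [Algebra F N]
    [Algebra G N] [IsScalarTower F G N] [Algebra.IsSeparable G N] : IsReduced (N ⊗[F] R) := by
  have : IsReduced (N ⊗[G] (G ⊗[F] R)) := isReduced_tensorProduct_of_isSeparable_of_isField hM
  exact isReduced_of_injective _ (Algebra.TensorProduct.cancelBaseChange F G G N R).symm.injective

variable {F R : Type*} [Field F] [Field R] [Algebra F R] (q : ℕ) [ExpChar F q]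

/-- If the `q ^ n`-th powers of a linearly independent family `b` lie in `F`, then they remain
linearly independent over the `q ^ n`-th powers in `R`. -/
theorem IsFrobeniusBasis.eq_zero_of_sum_pow_eq_zero {n : ℕ} {J : Type*} {β : J → F}
    (h : IsFrobeniusBasis F R q n β) {G ι : Type*} [Field G] [Algebra F G] {b : ι → G}
    (hb : LinearIndependent F b) (s : Finset ι) (f : ι → F)
    (hf : ∀ i ∈ s, algebraMap F G (f i) = b i ^ q ^ n) (r : ι → R)
    (hr : ∑ i ∈ s, algebraMap F R (f i) * r i ^ q ^ n = 0) : ∀ i ∈ s, r i = 0 := by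
  classical
  have : ExpChar R q := expChar_of_injective_algebraMap (algebraMap F R).injective q
  have : ExpChar G q := expChar_of_injective_algebraMap (algebraMap F G).injective q
  choose c hc using fun i ↦ h.exists_eq_sum (f i)
  let t : Finset J := s.biUnion fun i ↦ (c i).support
  have hft (i) (hi : i ∈ s) : f i = ∑ j ∈ t, c i j ^ q ^ n * β j := by
    conv_lhs => rw [hc i]
    refine Finsupp.sum_of_support_subset _ (fun j hj ↦ Finset.mem_biUnion.mpr ⟨i, hi, hj⟩) _ ?_
    simp [zero_pow (expChar_pow_pos F q n).ne']
  have hcr : ∀ j ∈ t, ∑ i ∈ s, algebraMap F R (c i j) * r i = 0 := by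
    refine h.eq_zero_of_sum_eq_zero t _ ?_
    rw [← hr]
    simp_rw [sum_pow_char_pow, Finset.sum_mul]
    rw [Finset.sum_comm]
    refine Finset.sum_congr rfl fun i hi ↦ ?_
    rw [hft i hi, map_sum, Finset.sum_mul]
    refine Finset.sum_congr rfl fun j _ ↦ ?_
    rw [map_mul, map_pow]
    ring
  intro i hi
  rw [← Module.forall_dual_apply_eq_zero_iff F]
  intro ℓ
  refine linearIndependent_iff'.mp hb s (fun i ↦ ℓ (r i)) ?_ i hi
  have hℓ (j) (hj : j ∈ t) : ∑ i ∈ s, c i j * ℓ (r i) = 0 := by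
    have := congrArg ℓ (hcr j hj)
    simpa [← Algebra.smul_def] using this
  apply eq_zero_of_pow_eq_zero (n := q ^ n)
  calc (∑ i ∈ s, ℓ (r i) • b i) ^ q ^ n
      = ∑ i ∈ s, algebraMap F G (f i * ℓ (r i) ^ q ^ n) := by
        rw [sum_pow_char_pow]
        refine Finset.sum_congr rfl fun i hi ↦ ?_
        rw [Algebra.smul_def, mul_pow, map_mul, hf i hi, map_pow, mul_comm]
    _ = algebraMap F G (∑ j ∈ t, (∑ i ∈ s, c i j * ℓ (r i)) ^ q ^ n * β j) := by
        rw [← map_sum]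
        congr 1
        simp_rw [sum_pow_char_pow, Finset.sum_mul]
        rw [Finset.sum_comm]
        refine Finset.sum_congr rfl fun i hi ↦ ?_
        rw [hft i hi, Finset.sum_mul]
        refine Finset.sum_congr rfl fun j _ ↦ ?_
        ring
    _ = 0 := by
        rw [Finset.sum_eq_zero, map_zero]
        intro j hj
        rw [hℓ j hj, zero_pow (expChar_pow_pos F q n).ne', zero_mul]

theorem isField_tensorProduct_of_isFrobeniusBasis
    (H : ∀ n, ∃ (J : Type u) (β : J → F), IsFrobeniusBasis F R q n β)
    (G : Type*) [Field G] [Algebra F G] [IsPurelyInseparable F G] : IsField (G ⊗[F] R) := by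
  classical
  have hinj : Function.Injective (Algebra.TensorProduct.includeRight : R →ₐ[F] G ⊗[F] R) :=
    Algebra.TensorProduct.includeRight_injective (algebraMap F G).injective
  have : Nontrivial (G ⊗[F] R) := hinj.nontrivial
  have : ExpChar (G ⊗[F] R) q :=
    expChar_of_injective_algebraMap (algebraMap F (G ⊗[F] R)).injective q
  have key (z : G ⊗[F] R) : ∃ (n : ℕ) (ρ : R), z ^ q ^ n = 1 ⊗ₜ ρ ∧ (ρ = 0 → z = 0) := by
    let b := Module.Basis.ofVectorSpace F G
    obtain ⟨c, rfl⟩ := TensorProduct.eq_repr_basis_left b z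
    choose N f₀ hf₀ using fun i ↦ IsPurelyInseparable.pow_mem F q (b i)
    let n := c.support.sup N
    let f i := f₀ i ^ q ^ (n - N i)
    have hf (i) (hi : i ∈ c.support) : algebraMap F G (f i) = b i ^ q ^ n := by
      rw [map_pow, hf₀, ← pow_mul, ← pow_add, Nat.add_sub_cancel' (Finset.le_sup hi)]
    refine ⟨n, ∑ i ∈ c.support, algebraMap F R (f i) * c i ^ q ^ n, ?_, fun h0 ↦ ?_⟩
    · rw [Finsupp.sum, sum_pow_char_pow, TensorProduct.tmul_sum]
      refine Finset.sum_congr rfl fun i hi ↦ ?_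
      rw [Algebra.TensorProduct.tmul_pow, ← hf i hi, Algebra.algebraMap_eq_smul_one,
        TensorProduct.smul_tmul, Algebra.smul_def]
    · obtain ⟨J, β, hβ⟩ := H n
      have := hβ.eq_zero_of_sum_pow_eq_zero q b.linearIndependent c.support f hf c h0
      refine Finset.sum_eq_zero fun i hi ↦ ?_
      simp [this i hi]
  refine ⟨exists_pair_ne _, mul_comm, fun {z} hz ↦ ?_⟩
  obtain ⟨n, ρ, hn, hρ⟩ := key z
  have hρ0 : ρ ≠ 0 := fun h ↦ hz (hρ h)
  have hu : IsUnit (z ^ q ^ n) := by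
    rw [hn]
    exact (IsUnit.mk0 ρ hρ0).map (Algebra.TensorProduct.includeRight : R →ₐ[F] G ⊗[F] R)
  rw [isUnit_pow_iff (expChar_pow_pos F q n).ne'] at hu
  exact hu.exists_right_inv

theorem isGeometricallyReduced_of_isFrobeniusBasis
    (H : ∀ n, ∃ (J : Type u) (β : J → F), IsFrobeniusBasis F R q n β) :
    Algebra.IsGeometricallyReduced F R := by
  rw [Algebra.isGeometricallyReduced_field_iff]
  let G := perfectClosure F (AlgebraicClosure F)
  have : Algebra.IsSeparable G (AlgebraicClosure F) := inferInstance
  exact isReduced_tensorProduct_of_isScalarTower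
    (isField_tensorProduct_of_isFrobeniusBasis q H G) (AlgebraicClosure F)

end

theorem isReduced_tensorProduct_of_isGeometricallyReduced (P T A F R : Type*) [CommRing P]
    [IsDomain P] [CommRing T] [Algebra P T] [Module.Flat P T] [CommRing A] [IsDomain A]
    [Algebra P A] [FaithfulSMul P A] [Algebra.IsIntegral P A] [Field F] [Algebra P F]
    [IsFractionRing P F] [Field R] [Algebra T R] [FaithfulSMul T R] [Algebra F R] [Algebra P R]
    [IsScalarTower P F R] [IsScalarTower P T R] [Algebra.IsGeometricallyReduced F R] :
    IsReduced (T ⊗[P] A) := by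
  let L := FractionRing A
  have hPL : Function.Injective (algebraMap P L) := FaithfulSMul.algebraMap_injective P L
  let : Algebra F L := (IsFractionRing.lift hPL).toAlgebra
  have : IsScalarTower P F L :=
    .of_algebraMap_eq fun x ↦ (IsFractionRing.lift_algebraMap hPL x).symm
  have : Algebra.IsAlgebraic P L := by
    have : Algebra.IsAlgebraic A L := IsLocalization.isAlgebraic L (nonZeroDivisors A)
    exact .trans P A L
  have : Algebra.IsAlgebraic F L := (IsFractionRing.comap_isAlgebraic_iff (A := P)).mp inferInstance
  have : IsReduced (L ⊗[F] R) := inferInstance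
  have : Module.Flat P F := IsLocalization.flat F (nonZeroDivisors P)
  have : Module.Flat P L := Module.Flat.trans P F L
  have : IsReduced (R ⊗[P] L) :=
    have := isReduced_of_injective _ (Algebra.TensorProduct.comm F R L).injective
    isReduced_of_injective _
      (IsLocalization.algebraTensorEquiv (nonZeroDivisors P) F R L).symm.injective
  refine isReduced_of_injective (Algebra.TensorProduct.map (IsScalarTower.toAlgHom P T R)
    (IsScalarTower.toAlgHom P A L)) ?_
  have h1 := Module.Flat.lTensor_preserves_injective_linearMap (M := T)
    (IsScalarTower.toAlgHom P A L).toLinearMap (FaithfulSMul.algebraMap_injective A L)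
  have h2 := Module.Flat.rTensor_preserves_injective_linearMap (M := L)
    (IsScalarTower.toAlgHom P T R).toLinearMap (FaithfulSMul.algebraMap_injective T R)
  convert h2.comp h1
  rw [← LinearMap.coe_comp, LinearMap.rTensor_comp_lTensor]
  rfl

/-- Noether normalization sending a maximal ideal to the origin. -/
theorem exists_finite_injective_algHom_forall_X_mem (K A : Type*) [Field K] [CommRing A]
    [Algebra K A] [Algebra.FiniteType K A] (m : Ideal A) [hm : m.IsMaximal] :
    ∃ (s : ℕ) (g : MvPolynomial (Fin s) K →ₐ[K] A), Function.Injective g ∧ g.Finite ∧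
      ∀ i, g (MvPolynomial.X i) ∈ m := by
  have : Nontrivial A := (Ideal.Quotient.mk_surjective (I := m)).nontrivial
  obtain ⟨s, g, hg, hfin⟩ := exists_finite_inj_algHom_of_fg K A
  have : Algebra.IsIntegral K (A ⧸ m) := by
    let := Ideal.Quotient.field m
    have := finite_of_finite_type_of_isJacobsonRing K (A ⧸ m)
    infer_instance
  have hint (i : Fin s) : IsIntegral K (Ideal.Quotient.mk m (g (.X i))) :=
    Algebra.IsIntegral.isIntegral _
  let f (i : Fin s) : Polynomial K := minpoly K (Ideal.Quotient.mk m (g (.X i)))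
  have hf0 (i : Fin s) : (f i).natDegree ≠ 0 := (minpoly.natDegree_pos (hint i)).ne'
  have hf (i : Fin s) : Transcendental K (f i) :=
    (f i).transcendental (hf0 i) (by simp [f, (minpoly.monic (hint i)).leadingCoeff])
  let y (i : Fin s) : MvPolynomial (Fin s) K := Polynomial.aeval (.X i) (f i)
  let φ : MvPolynomial (Fin s) K →ₐ[K] MvPolynomial (Fin s) K := MvPolynomial.aeval y
  have hφinj : Function.Injective φ := MvPolynomial.algebraicIndependent_polynomial_aeval_X f hf
  have hX (i : Fin s) : φ.toRingHom.IsIntegralElem (.X i) := by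
    refine ⟨(f i).map (algebraMap K (MvPolynomial (Fin s) K)) - Polynomial.C (.X i), ?_, ?_⟩
    · refine ((minpoly.monic (hint i)).map _).sub_of_left ?_
      refine Polynomial.degree_C_le.trans_lt ?_
      rw [Polynomial.degree_map]
      exact minpoly.degree_pos (hint i)
    · have : φ.toRingHom.comp (algebraMap K (MvPolynomial (Fin s) K)) =
        algebraMap K (MvPolynomial (Fin s) K) := φ.comp_algebraMap
      rw [Polynomial.eval₂_sub, Polynomial.eval₂_C, Polynomial.eval₂_map, this,
        ← Polynomial.aeval_def, sub_eq_zero]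
      exact (MvPolynomial.aeval_X y i).symm
  have hφfin : φ.Finite := by
    refine RingHom.IsIntegral.to_finite (fun x ↦ ?_) ?_
    · induction x using MvPolynomial.induction_on with
      | C a =>
        have : φ.toRingHom (.C a) = .C a := φ.commutes a
        exact this ▸ φ.toRingHom.isIntegralElem_map
      | add p q hp hq => exact RingHom.IsIntegralElem.add _ hp hq
      | mul_X p i hp => exact RingHom.IsIntegralElem.mul _ hp (hX i)
    · refine RingHom.FiniteType.of_comp_finiteType (f := algebraMap K (MvPolynomial (Fin s) K)) ?_
      have : φ.toRingHom.comp (algebraMap K (MvPolynomial (Fin s) K)) =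
        algebraMap K (MvPolynomial (Fin s) K) := φ.comp_algebraMap
      rw [this, RingHom.finiteType_algebraMap]
      infer_instance
  refine ⟨s, g.comp φ, hg.comp hφinj, hfin.comp hφfin, fun i ↦ ?_⟩
  rw [← Ideal.Quotient.eq_zero_iff_mem]
  have h1 : Ideal.Quotient.mkₐ K m (g (y i)) = 0 := by
    rw [← Polynomial.aeval_algHom_apply, ← Polynomial.aeval_algHom_apply]
    exact minpoly.aeval _ _
  rw [← h1]
  exact congrArg (fun z ↦ Ideal.Quotient.mk m (g z)) (MvPolynomial.aeval_X y i)

theorem isGeometricallyReduced_fractionRing_mvPowerSeries {σ K F R : Type u} [Finite σ] [Field K]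
    [Field F] [Field R] [Algebra F R] [Algebra (MvPolynomial σ K) F]
    [IsFractionRing (MvPolynomial σ K) F] [Algebra (MvPowerSeries σ K) R]
    [IsFractionRing (MvPowerSeries σ K) R]
    (hcomp : ∀ x : MvPolynomial σ K, algebraMap F R (algebraMap _ F x) =
      algebraMap (MvPowerSeries σ K) R x) :
    Algebra.IsGeometricallyReduced F R := by
  have : ExpChar (MvPolynomial σ K) (ringExpChar K) :=
    expChar_of_injective_ringHom (MvPolynomial.C_injective σ K) _
  have : ExpChar F (ringExpChar K) :=
    expChar_of_injective_algebraMap (IsFractionRing.injective (MvPolynomial σ K) F) _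
  exact isGeometricallyReduced_of_isFrobeniusBasis (ringExpChar K) fun n ↦
    exists_isFrobeniusBasis_mvPowerSeries K _ n σ F R hcomp

theorem MvPowerSeries.flat_mvPolynomial (σ K : Type*) [Finite σ] [CommRing K] [IsNoetherianRing K] :
    Module.Flat (MvPolynomial σ K) (MvPowerSeries σ K) :=
  have := AdicCompletion.flat_of_isNoetherian (MvPolynomial.idealOfVars σ K)
  .of_linearEquiv (toAdicCompletionAlgEquiv σ K).toLinearEquiv

theorem MvPowerSeries.isReduced_tensorProduct_mvPolynomial {σ K A : Type u} [Finite σ] [Field K]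
    [CommRing A] [IsDomain A] [Algebra (MvPolynomial σ K) A] [FaithfulSMul (MvPolynomial σ K) A]
    [Algebra.IsIntegral (MvPolynomial σ K) A] :
    IsReduced (MvPowerSeries σ K ⊗[MvPolynomial σ K] A) := by
  let P := MvPolynomial σ K
  let T := MvPowerSeries σ K
  have : IsDomain T := NoZeroDivisors.to_isDomain _
  let F := FractionRing P
  let R := FractionRing T
  have hPT : Function.Injective (algebraMap P T) := MvPolynomial.coe_injective σ K
  have : FaithfulSMul P T := (faithfulSMul_iff_algebraMap_injective P T).mpr hPT
  have : Module.Flat P T := MvPowerSeries.flat_mvPolynomial σ K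
  have : FaithfulSMul P R := .trans P T R
  let : Algebra F R := FractionRing.liftAlgebra P R
  have : IsScalarTower P F R := FractionRing.isScalarTower_liftAlgebra P R
  have : Algebra.IsGeometricallyReduced F R :=
    isGeometricallyReduced_fractionRing_mvPowerSeries (σ := σ) (K := K) fun x ↦ by
      rw [← IsScalarTower.algebraMap_apply P F R, IsScalarTower.algebraMap_apply P T R]
      rfl
  exact isReduced_tensorProduct_of_isGeometricallyReduced P T A F R

theorem MvPolynomial.isReduced_adicCompletion_idealOfVars_tensorProduct {σ K A : Type u} [Finite σ]
    [Field K] [CommRing A] [IsDomain A] [Algebra (MvPolynomial σ K) A]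
    [FaithfulSMul (MvPolynomial σ K) A] [Algebra.IsIntegral (MvPolynomial σ K) A] :
    IsReduced (AdicCompletion (idealOfVars σ K) (MvPolynomial σ K) ⊗[MvPolynomial σ K] A) :=
  have := MvPowerSeries.isReduced_tensorProduct_mvPolynomial (σ := σ) (K := K) (A := A)
  isReduced_of_injective _ (Algebra.TensorProduct.congr
    (MvPowerSeries.toAdicCompletionAlgEquiv σ K)
    (AlgEquiv.refl (R := MvPolynomial σ K) (A₁ := A))).symm.injective

theorem MvPolynomial.isArtinianRing_quotient_idealOfVars (σ K : Type*) [Field K] :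
    IsArtinianRing (MvPolynomial σ K ⧸ idealOfVars σ K) := by
  refine Function.Surjective.isArtinianRing
    (f := (Ideal.Quotient.mk (idealOfVars σ K)).comp (C : K →+* MvPolynomial σ K)) fun x ↦ ?_
  obtain ⟨p, rfl⟩ := Ideal.Quotient.mk_surjective x
  refine ⟨p.constantCoeff, ?_⟩
  rw [RingHom.comp_apply, Ideal.Quotient.eq, ← pow_one (idealOfVars σ K), mem_pow_idealOfVars_iff']
  intro m hm
  obtain rfl : m = 0 := by simpa [Finsupp.degree_eq_zero_iff] using hm
  simp [constantCoeff_eq]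

theorem isAdicallyReduced_of_isDomain {K A : Type u} [Field K] [CommRing A] [IsDomain A]
    [Algebra K A] [Algebra.FiniteType K A] (m : Ideal A) [m.IsMaximal] : IsAdicallyReduced m := by
  obtain ⟨s, g, hg, hfin, hX⟩ := exists_finite_injective_algHom_forall_X_mem K A m
  let e : MvPolynomial (ULift.{u} (Fin s)) K ≃ₐ[K] MvPolynomial (Fin s) K :=
    MvPolynomial.renameEquiv K Equiv.ulift
  let P := MvPolynomial (ULift.{u} (Fin s)) K
  let : Algebra P A := (g.comp e.toAlgHom).toRingHom.toAlgebra
  have : FaithfulSMul P A :=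
    (faithfulSMul_iff_algebraMap_injective P A).mpr (hg.comp e.injective)
  have : Module.Finite P A := hfin.comp (AlgHom.Finite.of_surjective _ e.surjective)
  let J := MvPolynomial.idealOfVars (ULift.{u} (Fin s)) K
  have : IsArtinianRing (P ⧸ J) := MvPolynomial.isArtinianRing_quotient_idealOfVars _ K
  have : Module.Finite (P ⧸ J) (A ⧸ J.map (algebraMap P A)) :=
    .of_restrictScalars_finite P _ _
  have : IsArtinianRing (A ⧸ J.map (algebraMap P A)) := .of_finite (P ⧸ J) _
  have hJm : J.map (algebraMap P A) ≤ m := by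
    refine Ideal.map_le_iff_le_comap.mpr (Ideal.span_le.mpr ?_)
    rintro _ ⟨i, rfl⟩
    have : e (.X i) = .X i.down := MvPolynomial.rename_X _ _
    exact (congrArg (g · ∈ m) this).mpr (hX i.down)
  have : IsNoetherianRing A := Algebra.FiniteType.isNoetherianRing K A
  exact .of_le hJm (.of_isReduced_tensorProduct
    MvPolynomial.isReduced_adicCompletion_idealOfVars_tensorProduct)

theorem IsAdicallyReduced.of_eq_top {A : Type*} [CommRing A] {I : Ideal A} (h : I = ⊤) :
    IsAdicallyReduced I := fun a _ _ k ↦ by simp [h, Ideal.top_pow]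

theorem isAdicallyReduced_of_isReduced {K A : Type u} [CommRing K] (hK : IsField K) [CommRing A]
    [IsReduced A] [Algebra K A] [Algebra.FiniteType K A] (m : Ideal A) (hm : m.IsMaximal) :
    IsAdicallyReduced m := by
  obtain ⟨_, rfl⟩ : ∃ i : Field K, i.toCommRing = ‹CommRing K› := ⟨hK.toField, rfl⟩
  have : IsNoetherianRing A := Algebra.FiniteType.isNoetherianRing K A
  refine .of_forall_minimalPrimes m fun p hp ↦ ?_
  have : p.IsPrime := hp.1.1
  obtain h | h := Ideal.map_eq_top_or_isMaximal_of_surjective (Ideal.Quotient.mk p)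
    Ideal.Quotient.mk_surjective hm
  · exact .of_eq_top h
  · exact isAdicallyReduced_of_isDomain (K := K) _

/-- If `A` is a reduced finite type algebra over a field `K` and `m` is a maximal ideal
of `A`, then the `m`-adic completion of `A` is reduced. -/
theorem isReduced_adicCompletion_of_isReduced
    (K A : Type*) [Field K] [CommRing A] [Algebra K A] (hft : Algebra.FiniteType K A)
    [IsReduced A] (m : Ideal A) (hm : m.IsMaximal) :
    IsReduced (AdicCompletion m A) := by
  have : Nontrivial A := (Ideal.Quotient.mk_surjective (I := m)).nontrivial
  have hfield : IsField (⊥ : Subalgebra K A) :=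
    (Algebra.botEquivOfInjective (algebraMap K A).injective).toMulEquiv.isField (Field.toIsField K)
  have : Algebra.FiniteType (⊥ : Subalgebra K A) A := .of_restrictScalars_finiteType K _ A
  exact (isAdicallyReduced_of_isReduced hfield m hm).isReduced_adicCompletion
end

section
/- Let K be a field, let A be a commutative K-algebra of finite type such that for every minimal prime p of A the localization A_p is reduced, and let m be a maximal ideal of A. Let Â denote the m-adic completion of A. Then for every minimal prime q of Â, the localization Â_q is reduced. (That is, generic reducedness passes to the complete local rings of a generically reduced finite-type scheme over a field at its closed points.) -/
/-- An ideal `I` is analytically reduced if the squaring map reflects `I`-adic convergence to `0`;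
this forces the `I`-adic completion to be reduced. -/
def Ideal.IsAnalyticallyReduced {R : Type*} [CommRing R] (I : Ideal R) : Prop :=
  ∀ n, ∃ N, ∀ b : R, b ^ 2 ∈ I ^ N → b ∈ I ^ n

/-- A form of the **Artin-Rees lemma**: along an injective finite extension of a Noetherian ring,
the adic topology on the base is the subspace topology. -/
theorem Ideal.exists_mem_pow_of_map_mem_pow_of_finite {R S : Type*} [CommRing R] [CommRing S]
    [IsNoetherianRing R] {f : R →+* S} (hf : f.Finite) (hinj : Function.Injective f)
    (I : Ideal R) (n : ℕ) : ∃ N, ∀ r, f r ∈ (I.map f) ^ N → r ∈ I ^ n := by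
  algebraize [f]
  obtain ⟨k, hk⟩ := I.exists_pow_inf_eq_pow_smul (LinearMap.range (Algebra.linearMap R S))
  refine ⟨n + k, fun r hr ↦ ?_⟩
  have hmem : algebraMap R S r ∈
      (I ^ (n + k) • ⊤ ⊓ LinearMap.range (Algebra.linearMap R S) : Submodule R S) := by
    refine ⟨?_, r, rfl⟩
    rw [← Ideal.map_pow] at hr
    simpa [Ideal.smul_top_eq_map, RingHom.algebraMap_toAlgebra] using hr
  rw [hk _ (by lia), Nat.add_sub_cancel] at hmem
  have hle := smul_mono_right (I ^ n)
    (inf_le_right : (I ^ k • ⊤ ⊓ LinearMap.range (Algebra.linearMap R S) : Submodule R S) ≤ _) hmem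
  rw [LinearMap.range_eq_map, ← Submodule.map_smul''] at hle
  obtain ⟨s, hs, hsr⟩ := hle
  obtain rfl := hinj (by simpa [RingHom.algebraMap_toAlgebra] using hsr)
  simpa using hs

/-- The Frobenius endomorphism of an algebra of finite type over a perfect field is finite. -/
theorem RingHom.finite_frobenius {K R : Type*} [Field K] [CommRing R] [Algebra K R]
    [Algebra.FiniteType K R] (p : ℕ) [ExpChar K p] [ExpChar R p] [PerfectRing K p] :
    (frobenius R p).Finite := by
  refine RingHom.IsIntegral.to_finite (fun x ↦ ?_) ?_
  · refine ⟨Polynomial.X ^ p - Polynomial.C x,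
      Polynomial.monic_X_pow_sub_C x (expChar_ne_zero R p), ?_⟩
    simp [frobenius_def]
  · refine RingHom.FiniteType.of_comp_finiteType (f := algebraMap K R) ?_
    rw [← RingHom.frobenius_comm]
    exact (RingHom.finiteType_algebraMap.mpr inferInstance).comp
      (RingHom.FiniteType.of_surjective _ (surjective_frobenius K p))

/-- All ideals of a reduced algebra of finite type over a perfect field of positive characteristic
are analytically reduced. -/
theorem Ideal.isAnalyticallyReduced_of_perfectRing {K R : Type*} [Field K] [CommRing R]
    [Algebra K R] [Algebra.FiniteType K R] [IsReduced R] (p : ℕ) [hp : Fact p.Prime]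
    [ExpChar K p] [ExpChar R p] [PerfectRing K p] (I : Ideal R) : I.IsAnalyticallyReduced := by
  intro n
  have := Algebra.FiniteType.isNoetherianRing K R
  obtain ⟨M, hM⟩ := Ideal.exists_mem_pow_of_map_mem_pow_of_finite
    (RingHom.finite_frobenius (K := K) (R := R) p) (frobenius_inj R p) I n
  obtain ⟨N, hN⟩ := Ideal.exists_pow_le_of_le_radical_of_fg (I := I)
    (J := I.map (frobenius R p) ^ M) (fun a ha ↦ ⟨p * M, by
      rw [pow_mul]; exact Ideal.pow_mem_pow (Ideal.mem_map_of_mem (frobenius R p) ha) M⟩)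
    (IsNoetherian.noetherian I)
  refine ⟨N, fun b hb ↦ hM b (hN ?_)⟩
  rw [frobenius_def, ← Nat.sub_add_cancel hp.out.two_le, pow_add]
  exact Ideal.mul_mem_left _ _ hb

section

open TensorProduct

/-- A finite subset of a base change to an algebraic extension is defined over a finite
subextension. -/
theorem IntermediateField.exists_finiteDimensional_subset_range_tensorProduct_map
    {K L R : Type*} [Field K] [Field L] [Algebra K L] [Algebra.IsAlgebraic K L] [CommRing R]
    [Algebra K R] {s : Set (L ⊗[K] R)} (hs : s.Finite) :
    ∃ E : IntermediateField K L, FiniteDimensional K E ∧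
      s ⊆ Set.range (Algebra.TensorProduct.map E.val (AlgHom.id K R)) := by
  obtain ⟨M, hM, hsM⟩ := TensorProduct.exists_finite_submodule_left_of_setFinite s hs
  obtain ⟨t, rfl⟩ := Module.Finite.iff_fg.mp hM
  refine ⟨IntermediateField.adjoin K t, IntermediateField.finiteDimensional_adjoin
    fun x _ ↦ Algebra.IsIntegral.isIntegral x, hsM.trans ?_⟩
  have hle : Submodule.span K (t : Set L) ≤
      Subalgebra.toSubmodule (IntermediateField.adjoin K (t : Set L)).toSubalgebra :=
    Submodule.span_le.mpr (IntermediateField.subset_adjoin K _)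
  rintro _ ⟨z, rfl⟩
  refine ⟨(Submodule.inclusion hle).rTensor R z, ?_⟩
  induction z with
  | zero => simp
  | tmul x y => rfl
  | add x y hx hy => simp only [map_add, hx, hy]

/-- Enlarging the base field is faithfully flat. -/
theorem RingHom.FaithfullyFlat.tensorProduct_map_toAlgHom (K E L R : Type*) [Field K] [Field E]
    [Field L] [Algebra K E] [Algebra K L] [Algebra E L] [IsScalarTower K E L] [CommRing R]
    [Algebra K R] : (Algebra.TensorProduct.map (IsScalarTower.toAlgHom K E L)
      (AlgHom.id K R)).toRingHom.FaithfullyFlat := by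
  let φ := Algebra.TensorProduct.map (IsScalarTower.toAlgHom K E L) (AlgHom.id K R)
  let e : (E ⊗[K] R) ⊗[E] L ≃ₐ[E] L ⊗[K] R := (Algebra.TensorProduct.comm E _ L).trans
    (Algebra.TensorProduct.cancelBaseChange K E E L R)
  have he : e.toRingEquiv.toRingHom.comp (algebraMap (E ⊗[K] R) ((E ⊗[K] R) ⊗[E] L)) =
      φ.toRingHom := by
    ext x
    · simp [e, φ, Algebra.smul_def]
    · simp [e, φ]
  let := φ.toRingHom.toAlgebra
  exact Module.FaithfullyFlat.of_linearEquiv (E ⊗[K] R) ((E ⊗[K] R) ⊗[E] L)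
    (AlgEquiv.ofRingEquiv (f := e.toRingEquiv) (DFunLike.congr_fun he)).symm.toLinearEquiv

/-- If the nilradical of `L ⊗[K] R` is defined over a finite subextension of `L / K`, then the
adic topologies of the reduced ring `R` are induced from the reduction of `L ⊗[K] R`. -/
theorem Ideal.exists_mem_pow_of_map_mem_pow_of_tensorProduct {K E L R : Type*} [Field K] [Field E]
    [Field L] [Algebra K E] [Algebra K L] [Algebra E L] [IsScalarTower K E L] [CommRing R]
    [Algebra K R] [FiniteDimensional K E] [IsReduced R] [IsNoetherianRing R]
    {s : Set (L ⊗[K] R)} (hs : Ideal.span s = nilradical (L ⊗[K] R))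
    (hsE : s ⊆ Set.range
      (Algebra.TensorProduct.map (IsScalarTower.toAlgHom K E L) (AlgHom.id K R)))
    (I : Ideal R) (n : ℕ) :
    let g : R →+* L ⊗[K] R ⧸ nilradical (L ⊗[K] R) := (Ideal.Quotient.mk _).comp
      (Algebra.TensorProduct.includeRight : R →ₐ[K] L ⊗[K] R).toRingHom
    ∃ N, ∀ r, g r ∈ I.map g ^ N → r ∈ I ^ n := by
  intro g
  let φ := Algebra.TensorProduct.map (IsScalarTower.toAlgHom K E L) (AlgHom.id K R)
  have hφ : φ.toRingHom.FaithfullyFlat := .tensorProduct_map_toAlgHom K E L R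
  have hcomap (J : Ideal (E ⊗[K] R)) : (J.map φ.toRingHom).comap φ.toRingHom = J := by
    algebraize [φ.toRingHom]
    exact Ideal.comap_map_eq_self_of_faithfullyFlat J
  have hN : (nilradical (E ⊗[K] R)).map φ.toRingHom = nilradical (L ⊗[K] R) := by
    refine le_antisymm
      (Ideal.map_le_iff_le_comap.mpr fun x hx ↦ (mem_nilradical.mp hx).map φ) ?_
    rw [← hs, Ideal.span_le]
    intro x hx
    obtain ⟨y, rfl⟩ := hsE hx
    have hφy : IsNilpotent (φ y) := by
      rw [← mem_nilradical, ← hs]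
      exact Ideal.subset_span hx
    exact Ideal.mem_map_of_mem φ.toRingHom ((IsNilpotent.map_iff hφ.injective).mp hφy)
  let i : R →+* E ⊗[K] R := (Algebra.TensorProduct.includeRight : R →ₐ[K] E ⊗[K] R).toRingHom
  have hi : i.Finite := by
    let := i.toAlgebra
    exact Module.Finite.of_equiv_equiv (A₁ := R) (B₁ := R ⊗[K] E) (RingEquiv.refl R)
      (Algebra.TensorProduct.comm K R E).toRingEquiv (by ext; simp; rfl)
  have hmk : Function.Surjective (Ideal.Quotient.mk (nilradical (E ⊗[K] R))) :=
    Ideal.Quotient.mk_surjective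
  have hinj : Function.Injective ((Ideal.Quotient.mk (nilradical (E ⊗[K] R))).comp i) := by
    rw [injective_iff_map_eq_zero]
    intro r hr
    have hnil : IsNilpotent (i r) := mem_nilradical.mp (Ideal.Quotient.eq_zero_iff_mem.mp hr)
    refine ((IsNilpotent.map_iff ?_).mp hnil).eq_zero
    exact Algebra.TensorProduct.includeRight_injective (algebraMap K E).injective
  obtain ⟨N, h⟩ := Ideal.exists_mem_pow_of_map_mem_pow_of_finite
    ((RingHom.Finite.of_surjective _ hmk).comp hi) hinj I n
  refine ⟨N, fun r hr ↦ h r ?_⟩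
  rw [← Ideal.map_map, ← Ideal.map_pow, RingHom.comp_apply, Ideal.mem_quotient_iff_mem_sup] at hr ⊢
  rw [← hcomap (_ ⊔ _), Ideal.mem_comap, Ideal.map_sup, hN, Ideal.map_pow, Ideal.map_map]
  have hcomp : φ.toRingHom.comp i =
      (Algebra.TensorProduct.includeRight : R →ₐ[K] L ⊗[K] R).toRingHom := by
    ext; simp [φ, i]
  rw [hcomp, ← RingHom.comp_apply, hcomp]
  exact hr

/-- All ideals of a reduced algebra of finite type over a field of positive characteristic are
analytically reduced. -/
theorem Ideal.isAnalyticallyReduced_of_charP {K R : Type*} [Field K] [CommRing R]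
    [IsReduced R] [Algebra K R] [Algebra.FiniteType K R] (p : ℕ) [hp : Fact p.Prime] [CharP K p]
    (I : Ideal R) : I.IsAnalyticallyReduced := by
  rcases subsingleton_or_nontrivial R with _ | _
  · exact fun n ↦ ⟨0, fun b _ ↦ Subsingleton.elim 0 b ▸ zero_mem _⟩
  let L := AlgebraicClosure K
  let T := L ⊗[K] R
  have := Algebra.FiniteType.isNoetherianRing K R
  have := Algebra.FiniteType.isNoetherianRing L T
  have : ExpChar K p := .prime hp.out
  have : ExpChar L p := expChar_of_injective_algebraMap (algebraMap K L).injective p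
  have : PerfectRing L p := PerfectField.toPerfectRing p
  have hne : nilradical T ≠ ⊤ := fun h ↦
    not_isNilpotent_one (mem_nilradical.mp ((Ideal.eq_top_iff_one _).mp h))
  have : Nontrivial (T ⧸ nilradical T) := Ideal.Quotient.nontrivial_iff.mpr hne
  have : ExpChar (T ⧸ nilradical T) p :=
    expChar_of_injective_algebraMap (algebraMap L (T ⧸ nilradical T)).injective p
  have : IsReduced (T ⧸ nilradical T) := by
    rw [← Ideal.isRadical_iff_quotient_reduced]
    exact Ideal.radical_isRadical _
  have : Algebra.FiniteType L (T ⧸ nilradical T) := inferInstance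
  obtain ⟨s, hs⟩ := IsNoetherian.noetherian (nilradical T)
  obtain ⟨E, _, hsE⟩ := IntermediateField.exists_finiteDimensional_subset_range_tensorProduct_map
    s.finite_toSet
  intro n
  obtain ⟨M, hM⟩ := Ideal.exists_mem_pow_of_map_mem_pow_of_tensorProduct hs hsE I n
  obtain ⟨N, hN⟩ := Ideal.isAnalyticallyReduced_of_perfectRing (K := L) p (I.map
    ((Ideal.Quotient.mk (nilradical T)).comp
      (Algebra.TensorProduct.includeRight : R →ₐ[K] T).toRingHom)) M
  refine ⟨N, fun b hb ↦ hM b (hN _ ?_)⟩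
  rw [← map_pow, ← Ideal.map_pow]
  exact Ideal.mem_map_of_mem _ hb

end

/-- A domain of finite type over a field of characteristic zero has finite integral closure. -/
theorem integralClosure.finite_of_charZero {K R L : Type*} [Field K] [CharZero K] [CommRing R]
    [IsDomain R] [Algebra K R] [Algebra.FiniteType K R] [Field L] [Algebra R L]
    [IsFractionRing R L] : Module.Finite R (integralClosure R L) := by
  obtain ⟨d, g, hg, hgfin⟩ := exists_finite_inj_algHom_of_fg K R
  let P := MvPolynomial (Fin d) K
  let := g.toRingHom.toAlgebra
  let := ((algebraMap R L).comp g.toRingHom).toAlgebra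
  have : IsScalarTower P R L := .of_algebraMap_eq' rfl
  have : Module.Finite P R := hgfin
  have : FaithfulSMul P R := (faithfulSMul_iff_algebraMap_injective _ _).mpr hg
  have : FaithfulSMul P L := .trans P R L
  let F := FractionRing P
  let : Algebra F L := FractionRing.liftAlgebra P L
  have : FiniteDimensional F L := .of_isLocalization P R (nonZeroDivisors P)
  have : Module.Finite P (integralClosure P L) := IsIntegralClosure.finite P F L _
  let f : integralClosure R L →ₗ[P] integralClosure P L :=
    LinearMap.codRestrict (Subalgebra.toSubmodule (integralClosure P L))
      ((integralClosure R L).val.toLinearMap.restrictScalars P)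
      (fun x ↦ isIntegral_trans (R := P) (A := R) _ x.2)
  have hf : Function.Injective f := fun x y h ↦ Subtype.ext (congrArg Subtype.val h :)
  have := Module.Finite.of_injective f hf
  exact Module.Finite.of_restrictScalars_finite P R _

theorem integralClosure.finite_of_injective {R S T : Type*} [CommRing R] [CommRing S] [CommRing T]
    [Algebra R S] [Algebra R T] [IsNoetherianRing R] {f : S →ₐ[R] T} (hf : Function.Injective f)
    (hfin : Module.Finite R (integralClosure R T)) : Module.Finite R (integralClosure R S) := by
  let g : integralClosure R S →ₗ[R] integralClosure R T :=
    LinearMap.codRestrict (Subalgebra.toSubmodule (integralClosure R T))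
      (f.toLinearMap ∘ₗ (integralClosure R S).val.toLinearMap) (fun x ↦ x.2.map f)
  exact Module.Finite.of_injective g fun x y h ↦ Subtype.ext (hf (congrArg Subtype.val h :))

open Polynomial in
/-- The Rees algebra of a nonzero ideal of a domain `R` has the same fraction field as `R[X]`. -/
theorem reesAlgebra.isFractionRing {R L : Type*} [CommRing R] [IsDomain R] {I : Ideal R}
    (hI : I ≠ ⊥) [Field L] [Algebra R[X] L] [IsFractionRing R[X] L] :
    IsFractionRing (reesAlgebra I) L := by
  obtain ⟨a, ha, ha0⟩ := Submodule.exists_mem_ne_zero_of_ne_bot hI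
  have hmem {d : ℕ} {f : R[X]} (hf : f.natDegree ≤ d) : C (a ^ d) * f ∈ reesAlgebra I := by
    refine (mem_reesAlgebra_iff I _).mpr fun i ↦ ?_
    rw [coeff_C_mul]
    rcases le_or_gt i d with hi | hi
    · exact Ideal.mul_mem_right _ _ (Ideal.pow_le_pow_right hi (Ideal.pow_mem_pow ha d))
    · simp [coeff_eq_zero_of_natDegree_lt (hf.trans_lt hi)]
  have : FaithfulSMul (reesAlgebra I) L :=
    (faithfulSMul_iff_algebraMap_injective _ _).mpr
      ((IsFractionRing.injective R[X] L).comp Subtype.val_injective)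
  refine IsFractionRing.of_field _ _ fun z ↦ ?_
  obtain ⟨f, g, hg, rfl⟩ := IsFractionRing.div_surjective (A := R[X]) z
  refine ⟨⟨_, hmem (le_max_left f.natDegree g.natDegree)⟩,
    ⟨_, hmem (le_max_right f.natDegree g.natDegree)⟩, ?_⟩
  have h0 : algebraMap R[X] L (C (a ^ max f.natDegree g.natDegree)) ≠ 0 := by
    simpa using fun h ↦ absurd h ha0
  change _ = algebraMap R[X] L (_ * f) / algebraMap R[X] L (_ * g)
  rw [map_mul, map_mul, mul_div_mul_left _ _ h0]

open Polynomial in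
/-- Over a field of characteristic zero, the Rees algebra has finite integral closure in `R[X]`. -/
theorem reesAlgebra.finite_integralClosure {K R : Type*} [Field K] [CharZero K]
    [CommRing R] [IsDomain R] [Algebra K R] [Algebra.FiniteType K R] {I : Ideal R} (hI : I ≠ ⊥) :
    Module.Finite (reesAlgebra I) (integralClosure (reesAlgebra I) R[X]) := by
  have := Algebra.FiniteType.isNoetherianRing K R
  have : Algebra.FiniteType K (reesAlgebra I) := .trans (S := R) inferInstance inferInstance
  have := reesAlgebra.isFractionRing (L := FractionRing R[X]) hI
  exact integralClosure.finite_of_injective (R := reesAlgebra I)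
    (f := IsScalarTower.toAlgHom (reesAlgebra I) R[X] (FractionRing R[X]))
    (IsFractionRing.injective R[X] _) (integralClosure.finite_of_charZero (K := K))

open Polynomial in
/-- If the integral closure of the Rees algebra in `R[X]` is a finite module, then coefficients of
its elements lie in the expected powers of `I`, up to a uniform shift. -/
theorem reesAlgebra.exists_forall_isIntegral_coeff_mem {R : Type*} [CommRing R] {I : Ideal R}
    [Module.Finite (reesAlgebra I) (integralClosure (reesAlgebra I) R[X])] :
    ∃ c, ∀ f : R[X], IsIntegral (reesAlgebra I) f → ∀ i, f.coeff i ∈ I ^ (i - c) := by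
  obtain ⟨s, hs⟩ := Module.Finite.fg_top (R := reesAlgebra I)
    (M := integralClosure (reesAlgebra I) R[X])
  let c := s.sup fun m ↦ (m : R[X]).natDegree
  refine ⟨c, fun f hf ↦ ?_⟩
  have hspan : (⟨f, hf⟩ : integralClosure (reesAlgebra I) R[X]) ∈
      Submodule.span (reesAlgebra I) (s : Set (integralClosure (reesAlgebra I) R[X])) :=
    hs ▸ Submodule.mem_top
  suffices ∀ x ∈ Submodule.span (reesAlgebra I) (s : Set (integralClosure (reesAlgebra I) R[X])),
      ∀ i, (x : R[X]).coeff i ∈ I ^ (i - c) from this _ hspan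
  intro x hx
  induction hx using Submodule.span_induction with
  | mem x hx =>
    intro i
    rcases le_or_gt i c with hi | hi
    · simp [Nat.sub_eq_zero_of_le hi]
    · have hle : (x : R[X]).natDegree ≤ c :=
        Finset.le_sup (f := fun m ↦ (Subtype.val m).natDegree) hx
      rw [coeff_eq_zero_of_natDegree_lt (hle.trans_lt hi)]
      exact zero_mem _
  | zero => simp
  | add x y _ _ hx hy => exact fun i ↦ by simpa using add_mem (hx i) (hy i)
  | smul r x _ hx =>
    intro i
    change ((r : R[X]) * (x : R[X])).coeff i ∈ _
    rw [coeff_mul]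
    refine sum_mem fun ⟨j, k⟩ hjk ↦ ?_
    rw [Finset.HasAntidiagonal.mem_antidiagonal] at hjk
    have h := Ideal.mul_mem_mul ((mem_reesAlgebra_iff I _).mp r.2 j) (hx k)
    rw [← pow_add] at h
    exact Ideal.pow_le_pow_right (by lia) h

open Polynomial in
/-- All ideals of a domain of finite type over a field of characteristic zero are analytically
reduced. -/
theorem Ideal.isAnalyticallyReduced_of_charZero {K R : Type*} [Field K] [CharZero K] [CommRing R]
    [IsDomain R] [Algebra K R] [Algebra.FiniteType K R] (I : Ideal R) :
    I.IsAnalyticallyReduced := by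
  intro n
  rcases eq_or_ne I ⊥ with rfl | hI
  · exact ⟨1, fun b hb ↦ by
      rw [pow_eq_zero_iff two_ne_zero |>.mp (by simpa using hb : b ^ 2 = 0)]
      exact zero_mem _⟩
  have := reesAlgebra.finite_integralClosure (K := K) hI
  obtain ⟨c, hc⟩ := reesAlgebra.exists_forall_isIntegral_coeff_mem (I := I)
  refine ⟨(n + c) * 2, fun b hb ↦ ?_⟩
  have hsq : monomial (n + c) b ^ 2 ∈ reesAlgebra I := by
    rw [monomial_pow]
    exact reesAlgebra.monomial_mem.mpr hb
  have hint : IsIntegral (reesAlgebra I) (monomial (n + c) b) :=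
    .of_pow two_pos (isIntegral_algebraMap (x := (⟨_, hsq⟩ : reesAlgebra I)))
  simpa using hc _ hint (n + c)

/-- All ideals of a domain of finite type over a field are analytically reduced. -/
theorem Ideal.isAnalyticallyReduced_of_isDomain {K R : Type*} [Field K] [CommRing R] [IsDomain R]
    [Algebra K R] [Algebra.FiniteType K R] (I : Ideal R) : I.IsAnalyticallyReduced := by
  obtain ⟨p, _⟩ := CharP.exists K
  rcases CharP.char_is_prime_or_zero K p with hp | rfl
  · have : Fact p.Prime := ⟨hp⟩
    exact Ideal.isAnalyticallyReduced_of_charP (K := K) p I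
  · have := CharP.charP_to_charZero K
    exact Ideal.isAnalyticallyReduced_of_charZero (K := K) I

/-- A minimal prime with reduced localization is killed by an element outside of it. -/
theorem Ideal.exists_notMem_forall_mul_eq_zero_of_isReduced {A : Type*} [CommRing A]
    {p : Ideal A} [p.IsPrime] (hfg : p.FG) (hp : p ∈ minimalPrimes A)
    (h : IsReduced (Localization.AtPrime p)) : ∃ f ∉ p, ∀ a ∈ p, f * a = 0 := by
  have key : ∀ a ∈ p, ∃ s ∉ p, s * a = 0 := by
    intro a ha
    have hnil : IsNilpotent (algebraMap A (Localization.AtPrime p) a) := by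
      refine nilpotent_iff_mem_prime.mpr fun Q hQ ↦ ?_
      obtain ⟨h₁, h₂⟩ := (IsLocalization.AtPrime.orderIsoOfPrime _ p ⟨Q, hQ⟩).2
      exact hp.2 ⟨h₁, bot_le⟩ h₂ ha
    obtain ⟨s, hs⟩ := (IsLocalization.map_eq_zero_iff p.primeCompl _ a).mp hnil.eq_zero
    exact ⟨s, s.2, hs⟩
  choose! s hs hsa using key
  obtain ⟨T, rfl⟩ := hfg
  refine ⟨∏ a ∈ T, s a, fun hmem ↦ ?_, fun a ha ↦ ?_⟩
  · obtain ⟨a, ha, h'⟩ := (Ideal.IsPrime.prod_mem_iff).mp hmem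
    exact hs a (Ideal.subset_span ha) h'
  · induction ha using Submodule.span_induction with
    | mem x hx =>
      obtain ⟨c, hc⟩ := Finset.dvd_prod_of_mem s hx
      rw [hc, mul_right_comm, hsa x (Ideal.subset_span hx), zero_mul]
    | zero => simp
    | add x y _ _ hx hy => rw [mul_add, hx, hy, add_zero]
    | smul r x _ hx => rw [smul_eq_mul, mul_left_comm, hx, mul_zero]

/-- If the image of `m` in `A ⧸ p` is analytically reduced and `f * p = 0`, then `f` kills all
square-zero elements of the `m`-adic completion of `A`. -/
theorem AdicCompletion.algebraMap_mul_eq_zero_of_sq_eq_zero {A : Type*} [CommRing A]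
    {m p : Ideal A} (hm : (m.map (Ideal.Quotient.mk p)).IsAnalyticallyReduced) {f : A}
    (hf : ∀ a ∈ p, f * a = 0) {x : AdicCompletion m A} (hx : x ^ 2 = 0) :
    algebraMap A (AdicCompletion m A) f * x = 0 := by
  refine AdicCompletion.ext_evalₐ fun n ↦ ?_
  obtain ⟨N, hN⟩ := hm n
  obtain ⟨a, rfl⟩ := AdicCompletion.mk_surjective m A x
  have hsq : a.val (max N n) ^ 2 ∈ m ^ N := by
    have := congrArg (AdicCompletion.evalₐ m (max N n)) hx
    rw [map_pow, AdicCompletion.evalₐ_mk, _root_.map_zero, ← map_pow, Ideal.Quotient.eq_zero_iff_mem]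
      at this
    exact Ideal.pow_le_pow_right (le_max_left _ _) this
  have hmem := hN (Ideal.Quotient.mk p (a.val (max N n))) (by
    rw [← map_pow, ← Ideal.map_pow]; exact Ideal.mem_map_of_mem _ hsq)
  rw [← Ideal.map_pow, Ideal.mem_quotient_iff_mem_sup] at hmem
  obtain ⟨u, hu, v, hv, huv⟩ := Submodule.mem_sup.mp hmem
  have hcong : a.val n - a.val (max N n) ∈ m ^ n := by
    have := a.2 (le_max_right N n)
    rw [SModEq.sub_mem] at this
    simpa using this
  have : f * a.val n ∈ m ^ n := by
    have h1 : f * a.val n = f * (a.val n - a.val (max N n)) + f * u := by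
      rw [← huv]; linear_combination hf v hv
    rw [h1]
    exact add_mem (Ideal.mul_mem_left _ _ hcong) (Ideal.mul_mem_left _ _ hu)
  rw [map_mul, _root_.map_zero, AlgHom.commutes, AdicCompletion.evalₐ_mk,
    Ideal.Quotient.algebraMap_eq, ← map_mul, Ideal.Quotient.eq_zero_iff_mem]
  exact this

/-- If `A` is a finite type algebra over a field `K` which is generically reduced
(its localizations at all minimal primes are reduced), and `m` is a maximal ideal of
`A`, then the `m`-adic completion of `A` is generically reduced. -/
theorem generically_reduced_adicCompletion
    (K A : Type*) [Field K] [CommRing A] [Algebra K A] (hft : Algebra.FiniteType K A)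
    (hA : ∀ (p : Ideal A) [p.IsPrime], p ∈ minimalPrimes A →
      IsReduced (Localization.AtPrime p))
    (m : Ideal A) (hm : m.IsMaximal) :
    ∀ (q : Ideal (AdicCompletion m A)) [q.IsPrime],
      q ∈ minimalPrimes (AdicCompletion m A) →
        IsReduced (Localization.AtPrime q) := by
  intro q _ hq
  have := Algebra.FiniteType.isNoetherianRing K A
  have := Algebra.HasGoingDown.of_flat (R := A) (S := AdicCompletion m A)
  have hp : q.under A ∈ minimalPrimes A := by
    obtain ⟨p₀, hp₀, hle⟩ := Ideal.exists_minimalPrimes_le (bot_le : ⊥ ≤ q.under A)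
    have := hp₀.1.1
    obtain ⟨Q, hQq, hQ, hQp⟩ := Ideal.exists_ideal_le_liesOver_of_le q hle
    have : q ≤ Q := hq.2 ⟨hQ, bot_le⟩ hQq
    rwa [le_antisymm this hQq, ← hQp.over]
  obtain ⟨f, hfq, hf⟩ := Ideal.exists_notMem_forall_mul_eq_zero_of_isReduced
    (IsNoetherian.noetherian _) hp (hA _ hp)
  rw [isReduced_iff_pow_one_lt 2 one_lt_two]
  intro x hx
  obtain ⟨⟨y, s⟩, hys⟩ := IsLocalization.surj q.primeCompl x
  have hy : algebraMap _ (Localization.AtPrime q) (y ^ 2) = 0 := by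
    rw [map_pow, ← hys, mul_pow, hx, zero_mul]
  obtain ⟨t, ht⟩ := (IsLocalization.map_eq_zero_iff q.primeCompl _ _).mp hy
  have hz := AdicCompletion.algebraMap_mul_eq_zero_of_sq_eq_zero (x := t * y)
    (Ideal.isAnalyticallyReduced_of_isDomain (K := K) (m.map (Ideal.Quotient.mk (q.under A)))) hf
    (by linear_combination (t : AdicCompletion m A) * ht)
  rw [← mul_assoc] at hz
  have hzero := (IsLocalization.map_eq_zero_iff q.primeCompl (Localization.AtPrime q) y).mpr
    ⟨⟨_, q.primeCompl.mul_mem hfq t.2⟩, hz⟩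
  rw [hzero] at hys
  exact (IsLocalization.map_units _ s).mul_left_eq_zero.mp hys
end
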